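/- The kernel of ψ equals yH ∗ yH: ker ψ = span_ℚ{ w₁ ∗ w₂ : w₁, w₂ ∈ yH }. -/

import Mathlib

open scoped BigOperators

/-- `H¹`: the ℚ-vector space with basis the words `z_{k₁}⋯z_{k_r}` in the letters
`z_k` (`k` a positive integer), encoded as finitely supported functions on lists. -/
abbrev H1 : Type := List ℕ+ →₀ ℚ

/-- The basis word `z_{k₁}⋯z_{k_r}` of `H¹` (the empty list is the unit `1`). -/
noncomputable def W (l : List ℕ+) : H1 := Finsupp.single l 1

/-- Left multiplication by the letter `z_k` (linear extension of `w ↦ z_k w`). -/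
noncomputable def consL (k : ℕ+) (h : H1) : H1 := Finsupp.mapDomain (fun w => k :: w) h

/-- Right multiplication by the letter `z_k` (linear extension of `w ↦ w z_k`). -/
noncomputable def mulRk (k : ℕ+) (h : H1) : H1 := Finsupp.mapDomain (fun w => w ++ [k]) h

/-- The harmonic (stuffle) product on words:
`1 ∗ u = u ∗ 1 = u`, `z_k u ∗ z_l v = z_k(u ∗ z_l v) + z_l(z_k u ∗ v) + z_{k+l}(u ∗ v)`. -/
noncomputable def harmW : List ℕ+ → List ℕ+ → H1
  | [], v => W v
  | u, [] => W u
  | k :: u, l :: v =>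
      consL k (harmW u (l :: v)) + consL l (harmW (k :: u) v) + consL (k + l) (harmW u v)
  termination_by u v => u.length + v.length

/-- The harmonic product `∗` on `H¹`, as the ℚ-bilinear extension of `harmW`. -/
noncomputable def harm (g h : H1) : H1 :=
  g.sum fun u c => h.sum fun v d => (c * d) • harmW u v

/-- The product `ш̃` on words in the letters `z_k`:
`1 ш̃ u = u ш̃ 1 = u`, `z_k u ш̃ z_l v = z_k(u ш̃ z_l v) + z_l(z_k u ш̃ v)`. -/
noncomputable def shtW : List ℕ+ → List ℕ+ → H1
  | [], v => W v
  | u, [] => W u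
  | k :: u, l :: v => consL k (shtW u (l :: v)) + consL l (shtW (k :: u) v)
  termination_by u v => u.length + v.length

/-- The shuffle product `ш̃` on `H¹` (on the alphabet `z₁, z₂, …`), bilinear extension. -/
noncomputable def sht (g h : H1) : H1 :=
  g.sum fun u c => h.sum fun v d => (c * d) • shtW u v

/-- Addition of a natural number to a positive natural number. -/
def pplus (k : ℕ+) (e : ℕ) : ℕ+ := ⟨(k : ℕ) + e, by have := k.pos; omega⟩

/-- `σ_m` on words: `σ_m(z_{k₁}⋯z_{k_r}) = Σ_{e₁+⋯+e_r=m} ∏_j C(k_j+e_j-1, e_j) z_{k₁+e₁}⋯z_{k_r+e_r}`,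
which is the word formula for `σ_m(1) = δ_{m,0}`, `σ_m(yw) = y(w ш x^m)`. -/
noncomputable def sigW : ℕ → List ℕ+ → H1
  | m, [] => if m = 0 then W [] else 0
  | m, k :: ks => ∑ e ∈ Finset.range (m + 1),
      ((((k : ℕ) + e - 1).choose e : ℚ)) • consL (pplus k e) (sigW (m - e) ks)
  termination_by m ks => ks.length

/-- `σ_m : H¹ → H¹`, linear extension. -/
noncomputable def sig (m : ℕ) (h : H1) : H1 := h.sum fun ks c => c • sigW m ks

/-- `S` on words: the word formula for `S(1) = 1`, `S(yw) = y S₁(w)` where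
`S₁(x) = x`, `S₁(y) = x + y`; explicitly `S(z_{k₁}⋯z_{k_r})` is the sum over all ways of
replacing separating commas by `+`. -/
noncomputable def StW : List ℕ+ → H1
  | [] => W []
  | [k] => W [k]
  | k :: l :: ks => consL k (StW (l :: ks)) + StW ((k + l) :: ks)
  termination_by ks => ks.length

/-- `S : H¹ → H¹`, linear extension. -/
noncomputable def St (h : H1) : H1 := h.sum fun ks c => c • StW ks

/-- `S̃ = S ∘ d` on words, where `d(x) = x`, `d(y) = -y`, so `d` multiplies a word of
depth `r` by `(-1)^r`. -/
noncomputable def SttW (ks : List ℕ+) : H1 := ((-1 : ℚ)) ^ ks.length • StW ks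

/-- `S̃ = S ∘ d : H¹ → H¹`, linear extension. -/
noncomputable def Stt (h : H1) : H1 := h.sum fun ks c => c • SttW ks

/-- `ψ` on words: `ψ(z_{k₁}⋯z_{k_r}) = Σ_{i=0}^{r-1} z_{k₁}⋯z_{k_i} ∗ S̃(σ₁(z_{k_r}⋯z_{k_{i+1}}))`. -/
noncomputable def psiW (ks : List ℕ+) : H1 :=
  ∑ i ∈ Finset.range ks.length, harm (W (ks.take i)) (Stt (sigW 1 ((ks.drop i).reverse)))

/-- `ψ : yH → H¹`, linear extension. -/
noncomputable def psi (h : H1) : H1 := h.sum fun ks c => c • psiW ks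

/-- `ψ̄` on words: `ψ̄(z_{k₁}⋯z_{k_r}) = Σ_{i=0}^{r-1} (-1)^{r-i} z_{k₁}⋯z_{k_i} ш̃ σ₁(z_{k_r}⋯z_{k_{i+1}})`. -/
noncomputable def psibW (ks : List ℕ+) : H1 :=
  ∑ i ∈ Finset.range ks.length,
    ((-1 : ℚ)) ^ (ks.length - i) • sht (W (ks.take i)) (sigW 1 ((ks.drop i).reverse))

/-- `ψ̄ : yH → H¹`, linear extension. -/
noncomputable def psib (h : H1) : H1 := h.sum fun ks c => c • psibW ks

/-- `ρ` on words:
`ρ(z_{k₁}⋯z_{k_r}) = Σ_{i=1}^{r} (-1)^{r-i} (z_{k₁}⋯z_{k_{i-1}} ш̃ z_{k_r}⋯z_{k_{i+1}}) z_{k_i}`. -/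
noncomputable def rhoW (ks : List ℕ+) : H1 :=
  ∑ i : Fin ks.length, ((-1 : ℚ)) ^ (ks.length - 1 - (i : ℕ)) •
    mulRk (ks.get i) (sht (W (ks.take (i : ℕ))) (W ((ks.drop ((i : ℕ) + 1)).reverse)))

/-- `ρ : yH → yH`, linear extension. -/
noncomputable def rho (h : H1) : H1 := h.sum fun ks c => c • rhoW ks

/-- `yH ⊆ H¹`: the span of the nonempty words `z_{k₁}⋯z_{k_r}` (`r ≥ 1`). -/
noncomputable def yH1 : Submodule ℚ H1 := Submodule.span ℚ {h | ∃ k ks, h = W (k :: ks)}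

/-- `yH ∗ yH`: the ℚ-span of the harmonic products `w₁ ∗ w₂` with `w₁, w₂ ∈ yH`. -/
noncomputable def harmSpan : Submodule ℚ H1 :=
  Submodule.span ℚ {h | ∃ u ∈ yH1, ∃ v ∈ yH1, h = harm u v}

/-- `yH ш̃ yH`: the ℚ-span of the products `w₁ ш̃ w₂` with `w₁, w₂ ∈ yH`. -/
noncomputable def shtSpan : Submodule ℚ H1 :=
  Submodule.span ℚ {h | ∃ u ∈ yH1, ∃ v ∈ yH1, h = sht u v}


open TensorProduct

/-- Type synonym of `H1` carrying the harmonic ring structure. -/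
def QS : Type := List ℕ+ →₀ ℚ

namespace QS

noncomputable instance : AddCommGroup QS := inferInstanceAs (AddCommGroup (List ℕ+ →₀ ℚ))
noncomputable instance : Module ℚ QS := inferInstanceAs (Module ℚ (List ℕ+ →₀ ℚ))

/-- identification -/
noncomputable def of : H1 ≃ₗ[ℚ] QS := LinearEquiv.refl ℚ (List ℕ+ →₀ ℚ)

/-- basis word -/
noncomputable def e (w : List ℕ+) : QS := of (W w)

/-- linear extension -/
noncomputable def lift {M : Type*} [AddCommGroup M] [Module ℚ M] (f : List ℕ+ → M) : QS →ₗ[ℚ] M :=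
  (Finsupp.linearCombination ℚ f).comp (of.symm : QS →ₗ[ℚ] H1)

@[simp] lemma lift_e {M : Type*} [AddCommGroup M] [Module ℚ M] (f : List ℕ+ → M) (w : List ℕ+) :
    lift f (e w) = f w := by
  simp [lift, e, W]

lemma lift_of {M : Type*} [AddCommGroup M] [Module ℚ M] (f : List ℕ+ → M) (h : H1) :
    lift f (of h) = h.sum fun u c => c • f u := by
  simp [lift, Finsupp.linearCombination_apply]

lemma ind {p : QS → Prop} (h0 : p 0) (ha : ∀ a b, p a → p b → p (a + b))
    (hs : ∀ (c : ℚ) a, p a → p (c • a)) (he : ∀ w, p (e w)) (a : QS) : p a := by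
  suffices h : ∀ x : H1, p (of x) from h a
  intro x
  induction x using Finsupp.induction_linear with
  | zero => simpa using h0
  | add f g hf hg => rw [map_add]; exact ha _ _ hf hg
  | single w c =>
    have : (Finsupp.single w c : H1) = c • W w := by simp [W]
    rw [this, map_smul]; exact hs _ _ (he w)

lemma hom_ext {M : Type*} [AddCommGroup M] [Module ℚ M] {f g : QS →ₗ[ℚ] M}
    (h : ∀ w, f (e w) = g (e w)) : f = g := by
  ext a
  induction a using ind with
  | h0 => simp
  | ha a b h1 h2 => simp [h1, h2]
  | hs c a h1 => simp [h1]
  | he w => exact h w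

/-- left concatenation by a letter -/
noncomputable def cons (k : ℕ+) : QS →ₗ[ℚ] QS := lift fun w => e (k :: w)

@[simp] lemma cons_e (k : ℕ+) (w) : cons k (e w) = e (k :: w) := by simp [cons]

lemma of_consL (k : ℕ+) (h : H1) : of (consL k h) = cons k (of h) := by
  have : of.toLinearMap.comp (Finsupp.lmapDomain ℚ ℚ (fun w => k :: w)) =
      (cons k).comp of.toLinearMap := by
    ext w : 2
    have := cons_e k w
    rw [e, e, W, W] at this
    simp [this]
  exact LinearMap.congr_fun this h

/-- the product as bilinear map -/
noncomputable def mulL : QS →ₗ[ℚ] QS →ₗ[ℚ] QS := lift fun u => lift fun v => of (harmW u v)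

lemma mulL_e (u v) : mulL (e u) (e v) = of (harmW u v) := by simp [mulL]

lemma of_harm (g h : H1) : of (harm g h) = mulL (of g) (of h) := by
  rw [mulL, lift_of, harm]
  simp only [Finsupp.sum, map_sum, LinearMap.sum_apply, LinearMap.smul_apply, lift_of, map_smul,
    Finset.smul_sum, mul_smul]

lemma nil_mulL (a) : mulL (e []) a = a := by
  have : mulL (e []) = LinearMap.id := hom_ext fun w => by rw [mulL_e]; simp [harmW, e]
  simp [this]

lemma mulL_nil (a) : mulL a (e []) = a := by
  have : mulL.flip (e []) = LinearMap.id := hom_ext fun w => by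
    rw [LinearMap.flip_apply, mulL_e]; cases w <;> simp [harmW, e]
  exact LinearMap.congr_fun this a

lemma mulL_cons_e (k l u v) : mulL (e (k :: u)) (e (l :: v)) =
    cons k (mulL (e u) (e (l :: v))) + cons l (mulL (e (k :: u)) (e v)) +
      cons (k + l) (mulL (e u) (e v)) := by
  rw [mulL_e, harmW]
  simp [of_consL, mulL_e]

lemma mulL_cons (k l) (a b : QS) : mulL (cons k a) (cons l b) =
    cons k (mulL a (cons l b)) + cons l (mulL (cons k a) b) + cons (k + l) (mulL a b) := by
  induction a using ind with
  | h0 => simp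
  | ha a b h1 h2 => simp only [map_add, LinearMap.add_apply, h1, h2]; abel
  | hs c a h1 => simp only [map_smul, LinearMap.smul_apply, h1, smul_add]
  | he u =>
    induction b using ind with
    | h0 => simp
    | ha a b h1 h2 => simp only [map_add, h1, h2]; abel
    | hs c a h1 => simp only [map_smul, h1, smul_add]
    | he v => simpa using mulL_cons_e k l u v

lemma mulL_comm_e : ∀ u v, mulL (e u) (e v) = mulL (e v) (e u)
  | [], v => by rw [nil_mulL, mulL_nil]
  | u, [] => by rw [nil_mulL, mulL_nil]
  | k :: u, l :: v => by
    rw [mulL_cons_e, mulL_cons_e, mulL_comm_e u (l :: v), mulL_comm_e (k :: u) v, mulL_comm_e u v,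
      add_comm k l]
    abel
  termination_by u v => u.length + v.length

lemma mulL_comm (a b) : mulL a b = mulL b a := by
  have : mulL = mulL.flip := hom_ext fun u => hom_ext fun v => by
    simpa using mulL_comm_e u v
  exact LinearMap.congr_fun (LinearMap.congr_fun this a) b

lemma mulL_assoc_e : ∀ u v w, mulL (mulL (e u) (e v)) (e w) = mulL (e u) (mulL (e v) (e w))
  | [], v, w => by simp only [nil_mulL]
  | u, [], w => by simp only [nil_mulL, mulL_nil]
  | u, v, [] => by simp only [mulL_nil]
  | k :: u, l :: v, m :: w => by
    have h1 := mulL_assoc_e u (l :: v) (m :: w)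
    have h2 := mulL_assoc_e (k :: u) v (m :: w)
    have h3 := mulL_assoc_e (k :: u) (l :: v) w
    have h4 := mulL_assoc_e u v (m :: w)
    have h5 := mulL_assoc_e u (l :: v) w
    have h6 := mulL_assoc_e (k :: u) v w
    have h7 := mulL_assoc_e u v w
    simp only [← cons_e] at *
    rw [mulL_cons l m] at h1
    rw [mulL_cons k l] at h3
    have H1 := congrArg (cons k) h1
    have H3 := congrArg (cons m) h3
    simp only [map_add, LinearMap.add_apply, mulL_cons k l, mulL_cons l m] at H1 H3 ⊢
    simp only [mulL_cons, h2, h4, h5, h6, h7, add_assoc k l m]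
    rw [H1, ← sub_eq_zero]
    have H3' := sub_eq_zero.2 H3
    rw [← H3']
    abel
  termination_by u v w => u.length + v.length + w.length

lemma mulL_assoc (a b c) : mulL (mulL a b) c = mulL a (mulL b c) := by
  induction a using ind with
  | h0 => simp
  | ha a b h1 h2 => simp only [map_add, LinearMap.add_apply, h1, h2]
  | hs c a h1 => simp only [map_smul, LinearMap.smul_apply, h1]
  | he u =>
  induction b using ind with
  | h0 => simp
  | ha a b h1 h2 => simp only [map_add, LinearMap.add_apply, h1, h2]
  | hs c a h1 => simp only [map_smul, LinearMap.smul_apply, h1]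
  | he v =>
  induction c using ind with
  | h0 => simp
  | ha a b h1 h2 => simp only [map_add, h1, h2]
  | hs c a h1 => simp only [map_smul, h1]
  | he w => exact mulL_assoc_e u v w

noncomputable instance : CommRing QS where
  __ := (inferInstance : AddCommGroup QS)
  mul a b := mulL a b
  one := e []
  mul_assoc := mulL_assoc
  one_mul := nil_mulL
  mul_one := mulL_nil
  left_distrib a b c := map_add (mulL a) b c
  right_distrib a b c := by
    change mulL (a + b) c = mulL a c + mulL b c
    simp
  zero_mul a := by
    change mulL 0 a = 0
    simp
  mul_zero a := map_zero (mulL a)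
  mul_comm := mulL_comm

lemma mul_def (a b : QS) : a * b = mulL a b := rfl
lemma one_def : (1 : QS) = e [] := rfl

noncomputable instance : Algebra ℚ QS :=
  Algebra.ofModule (fun r x y => by simp [mul_def]) (fun r x y => by simp [mul_def])

lemma cons_mul_cons (k l) (a b : QS) : cons k a * cons l b =
    cons k (a * cons l b) + cons l (cons k a * b) + cons (k + l) (a * b) := mulL_cons k l a b

/-- coproduct on words (deconcatenation) -/
noncomputable def DelW : List ℕ+ → QS ⊗[ℚ] QS
  | [] => 1 ⊗ₜ 1
  | k :: w => 1 ⊗ₜ e (k :: w) + (cons k).rTensor QS (DelW w)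

/-- coproduct -/
noncomputable def Del : QS →ₗ[ℚ] QS ⊗[ℚ] QS := lift DelW

/-- counit -/
noncomputable def eps : QS →ₗ[ℚ] ℚ := lift fun w => if w = [] then 1 else 0

@[simp] lemma eps_cons (k a) : eps (cons k a) = 0 := by
  have : eps.comp (cons k) = 0 := hom_ext fun w => by simp [eps]
  exact LinearMap.congr_fun this a

@[simp] lemma eps_e_cons (k w) : eps (e (k :: w)) = 0 := by simp [eps]

@[simp] lemma eps_one : eps 1 = 1 := by simp [eps, one_def]

lemma Del_one : Del 1 = 1 ⊗ₜ 1 := by rw [one_def, Del, lift_e, DelW]; rfl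

lemma Del_cons (k a) : Del (cons k a) = 1 ⊗ₜ cons k a + (cons k).rTensor QS (Del a) := by
  have : Del.comp (cons k) = (TensorProduct.mk ℚ QS QS 1).comp (cons k) +
      ((cons k).rTensor QS).comp Del := hom_ext fun w => by simp [Del, DelW]
  exact LinearMap.congr_fun this a

/-- induction on words, algebraic form -/
lemma hom_ext_cons {M : Type*} [AddCommGroup M] [Module ℚ M] {f g : QS →ₗ[ℚ] M}
    (h1 : f 1 = g 1) (h : ∀ k w, f (e w) = g (e w) → f (cons k (e w)) = g (cons k (e w))) :
    f = g := by
  refine hom_ext fun w => ?_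
  induction w with
  | nil => exact h1
  | cons k w ih => simpa using h k w ih

lemma rT_one (k) (X : QS ⊗[ℚ] QS) (b : QS) :
    (cons k).rTensor QS X * (1 ⊗ₜ b) = (cons k).rTensor QS (X * (1 ⊗ₜ b)) := by
  induction X using TensorProduct.induction_on with
  | zero => simp
  | add x y hx hy => simp only [map_add, add_mul, hx, hy]
  | tmul x y => simp

lemma rT_rT (k l) (X Y : QS ⊗[ℚ] QS) :
    (cons k).rTensor QS X * (cons l).rTensor QS Y =
      (cons k).rTensor QS (X * (cons l).rTensor QS Y) +
      (cons l).rTensor QS ((cons k).rTensor QS X * Y) +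
      (cons (k + l)).rTensor QS (X * Y) := by
  induction X using TensorProduct.induction_on with
  | zero => simp
  | add x y hx hy => simp only [map_add, add_mul, hx, hy]; abel
  | tmul x y =>
    induction Y using TensorProduct.induction_on with
    | zero => simp
    | add x y hx hy => simp only [map_add, mul_add, hx, hy]; abel
    | tmul z t => simp [cons_mul_cons, TensorProduct.add_tmul]

lemma Del_mul_e : ∀ u v, Del (e u * e v) = Del (e u) * Del (e v)
  | [], v => by rw [← one_def, one_mul, Del_one, ← Algebra.TensorProduct.one_def, one_mul]
  | u, [] => by rw [← one_def, mul_one, Del_one, ← Algebra.TensorProduct.one_def, mul_one]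
  | k :: u, l :: v => by
    have h1 := Del_mul_e u (l :: v)
    have h2 := Del_mul_e (k :: u) v
    have h3 := Del_mul_e u v
    simp only [← cons_e] at *
    have h4 := rT_one l (Del (e v)) (cons k (e u))
    rw [mul_comm, mul_comm (Del (e v))] at h4
    rw [cons_mul_cons, map_add, map_add, Del_cons, Del_cons, Del_cons, h1, h2, h3, Del_cons k,
      Del_cons l]
    simp only [add_mul, mul_add, map_add, rT_one, rT_rT, h4, Algebra.TensorProduct.tmul_mul_tmul,
      one_mul, cons_mul_cons, TensorProduct.tmul_add]
    abel
  termination_by u v => u.length + v.length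

lemma Del_mul (a b : QS) : Del (a * b) = Del a * Del b := by
  have : (LinearMap.mul ℚ QS).compr₂ Del = (LinearMap.mul ℚ (QS ⊗[ℚ] QS)).compl₁₂ Del Del :=
    hom_ext fun u => hom_ext fun v => Del_mul_e u v
  exact LinearMap.congr_fun (LinearMap.congr_fun this a) b

lemma eps_mul (a b : QS) : eps (a * b) = eps a * eps b := by
  have : (LinearMap.mul ℚ QS).compr₂ eps = (LinearMap.mul ℚ ℚ).compl₁₂ eps eps := by
    refine hom_ext_cons ?_ fun k u _ => hom_ext_cons ?_ fun l v _ => ?_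
    · ext; simp
    · simp
    · simp only [LinearMap.compr₂_apply, LinearMap.mul_apply', LinearMap.compl₁₂_apply,
        cons_mul_cons]
      simp
  exact LinearMap.congr_fun (LinearMap.congr_fun this a) b

noncomputable instance : Coalgebra ℚ QS where
  comul := Del
  counit := eps
  coassoc := by
    refine hom_ext_cons ?_ fun k u h => ?_
    · simp [Del_one]
    · simp only [LinearMap.comp_apply] at h ⊢
      simp only [Del_cons, map_add, LinearMap.rTensor_tmul, LinearMap.lTensor_tmul, Del_one,
        LinearEquiv.coe_coe, TensorProduct.assoc_tmul, TensorProduct.tmul_add, add_assoc] at h ⊢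
      congr 1
      have h1 : ∀ X : QS ⊗[ℚ] QS, TensorProduct.assoc ℚ QS QS QS (Del.rTensor QS
          ((cons k).rTensor QS X)) = 1 ⊗ₜ (cons k).rTensor QS X +
          (cons k).rTensor (QS ⊗[ℚ] QS) (TensorProduct.assoc ℚ QS QS QS (Del.rTensor QS X)) := by
        intro X
        induction X using TensorProduct.induction_on with
        | zero => simp
        | add x y hx hy => simp only [map_add, hx, hy, TensorProduct.tmul_add]; abel
        | tmul x y =>
          simp only [LinearMap.rTensor_tmul, Del_cons, TensorProduct.add_tmul, map_add,
            TensorProduct.assoc_tmul]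
          congr 1
          induction Del x using TensorProduct.induction_on with
          | zero => simp
          | add x y hx hy => simp only [map_add, hx, hy, TensorProduct.add_tmul]
          | tmul z t => simp
      have h2 : ∀ X : QS ⊗[ℚ] QS, Del.lTensor QS ((cons k).rTensor QS X) =
          (cons k).rTensor (QS ⊗[ℚ] QS) (Del.lTensor QS X) := by
        intro X
        induction X using TensorProduct.induction_on with
        | zero => simp
        | add x y hx hy => simp only [map_add, hx, hy]
        | tmul x y => simp
      rw [h1, h2, h]
  rTensor_counit_comp_comul := by
    refine hom_ext_cons ?_ fun k u h => ?_
    · simp [Del_one]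
    · have h2 : eps.rTensor QS ∘ₗ (cons k).rTensor QS = 0 := by
        rw [← LinearMap.rTensor_comp]
        have : eps ∘ₗ cons k = 0 := by ext; simp
        rw [this]; simp
      have h3 := LinearMap.congr_fun h2 (Del (e u))
      simp only [LinearMap.comp_apply] at h h3 ⊢
      rw [Del_cons, map_add, h3]
      simp
  lTensor_counit_comp_comul := by
    refine hom_ext_cons ?_ fun k u h => ?_
    · simp [Del_one]
    · have h2 : ∀ X : QS ⊗[ℚ] QS, eps.lTensor QS ((cons k).rTensor QS X) =
          (cons k).rTensor ℚ (eps.lTensor QS X) := by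
        intro X
        induction X using TensorProduct.induction_on with
        | zero => simp
        | add x y hx hy => simp only [map_add, hx, hy]
        | tmul x y => simp
      simp only [LinearMap.comp_apply] at h ⊢
      rw [Del_cons, map_add, h2, h]
      simp

noncomputable instance : Bialgebra ℚ QS :=
  Bialgebra.mk' ℚ QS eps_one (eps_mul _ _) Del_one (Del_mul _ _)

lemma comul_eq : (Coalgebra.comul : QS →ₗ[ℚ] QS ⊗[ℚ] QS) = Del := rfl
lemma counit_eq : (Coalgebra.counit : QS →ₗ[ℚ] ℚ) = eps := rfl

/-- convolution product of linear endomorphisms -/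
noncomputable def cv (f g : QS →ₗ[ℚ] QS) : QS →ₗ[ℚ] QS :=
  LinearMap.mul' ℚ QS ∘ₗ TensorProduct.map f g ∘ₗ Del

/-- unit of convolution -/
noncomputable def cone : QS →ₗ[ℚ] QS := Algebra.linearMap ℚ QS ∘ₗ eps

lemma cv_toConv (f g : QS →ₗ[ℚ] QS) :
    WithConv.toConv (cv f g) = WithConv.toConv f * WithConv.toConv g := rfl

lemma cone_toConv : WithConv.toConv cone = 1 := rfl

lemma cv_assoc (f g h) : cv (cv f g) h = cv f (cv g h) := by
  apply WithConv.toConv_injective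
  simp only [cv_toConv, mul_assoc]

lemma cv_cone (f) : cv f cone = f := by
  apply WithConv.toConv_injective
  simp only [cv_toConv, cone_toConv, mul_one]

lemma cone_cv (f) : cv cone f = f := by
  apply WithConv.toConv_injective
  simp only [cv_toConv, cone_toConv, one_mul]

lemma cv_one (f g) : cv f g 1 = f 1 * g 1 := by simp [cv, Del_one]

lemma cv_cons (f g k a) : cv f g (cons k a) = f 1 * g (cons k a) + cv (f ∘ₗ cons k) g a := by
  simp only [cv, LinearMap.comp_apply, Del_cons, map_add, TensorProduct.map_tmul,
    LinearMap.mul'_apply]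
  congr 2
  rw [← LinearMap.comp_apply, LinearMap.map_comp_rTensor]

lemma cv_e (f g) (w : List ℕ+) : cv f g (e w) =
    ∑ i ∈ Finset.range (w.length + 1), f (e (w.take i)) * g (e (w.drop i)) := by
  induction w generalizing f with
  | nil => rw [← one_def, cv_one]; simp [one_def]
  | cons k w ih =>
    rw [← cons_e, cv_cons, ih, List.length_cons, Finset.sum_range_succ' _ (w.length + 1)]
    simp [one_def, add_comm]

/-- right concatenation by a letter -/
noncomputable def snoc (m : ℕ+) : QS →ₗ[ℚ] QS := lift fun w => e (w ++ [m])

@[simp] lemma snoc_e (m w) : snoc m (e w) = e (w ++ [m]) := by simp [snoc]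

lemma snoc_cons (m k a) : snoc m (cons k a) = cons k (snoc m a) := by
  have : snoc m ∘ₗ cons k = cons k ∘ₗ snoc m := hom_ext fun w => by simp
  exact LinearMap.congr_fun this a

lemma Del_snoc (m a) : Del (snoc m a) = snoc m a ⊗ₜ 1 + (snoc m).lTensor QS (Del a) := by
  have : Del ∘ₗ snoc m = (TensorProduct.mk ℚ QS QS).flip 1 ∘ₗ snoc m +
      (snoc m).lTensor QS ∘ₗ Del := by
    refine hom_ext_cons ?_ fun k w h => ?_
    · have : snoc m 1 = cons m 1 := by simp [one_def]
      simp [this, Del_cons, Del_one]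
      abel
    · simp only [LinearMap.comp_apply, LinearMap.add_apply] at h ⊢
      have h2 : ∀ X : QS ⊗[ℚ] QS, (snoc m).lTensor QS ((cons k).rTensor QS X) =
          (cons k).rTensor QS ((snoc m).lTensor QS X) := by
        intro X
        induction X using TensorProduct.induction_on with
        | zero => simp
        | add x y hx hy => simp only [map_add, hx, hy]
        | tmul x y => simp
      rw [snoc_cons, Del_cons, h, Del_cons, map_add, map_add, h2, LinearMap.lTensor_tmul,
        snoc_cons]
      simp
      abel
  exact LinearMap.congr_fun this a

lemma cv_snoc (f g m a) : cv f g (snoc m a) = f (snoc m a) * g 1 + cv f (g ∘ₗ snoc m) a := by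
  simp only [cv, LinearMap.comp_apply, Del_snoc, map_add, TensorProduct.map_tmul,
    LinearMap.mul'_apply]
  congr 2
  rw [← LinearMap.comp_apply, LinearMap.map_comp_lTensor]

/-- merging a letter in the first letter -/
noncomputable def plusl (m : ℕ+) : QS →ₗ[ℚ] QS := lift fun w => match w with
  | [] => 0
  | l :: w => e ((m + l) :: w)

lemma plusl_one (m) : plusl m 1 = 0 := by simp [plusl, one_def]
lemma plusl_cons (m l a) : plusl m (cons l a) = cons (m + l) a := by
  have : plusl m ∘ₗ cons l = cons (m + l) := hom_ext fun w => by simp [plusl]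
  exact LinearMap.congr_fun this a

/-- cons plus merge -/
noncomputable def E (m : ℕ+) : QS →ₗ[ℚ] QS := cons m + plusl m

lemma plusl_plusl (k l a) : plusl k (plusl l a) = plusl (k + l) a := by
  have : plusl k ∘ₗ plusl l = plusl (k + l) := hom_ext_cons (by simp [plusl_one])
    fun m w _ => by simp only [LinearMap.comp_apply, plusl_cons, add_assoc]
  exact LinearMap.congr_fun this a

lemma plusl_E (k l a) : plusl k (E l a) = E (k + l) a := by
  simp [E, plusl_cons, plusl_plusl]

lemma StW_cons : ∀ (w : List ℕ+) (k), of (StW (k :: w)) = E k (of (StW w))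
  | [], k => by
    have := plusl_one k
    rw [StW, StW]
    change e [k] = E k (e [])
    simp [E, ← one_def, plusl_one]
    simp [one_def]
  | l :: w, k => by
    have h1 := StW_cons w (k + l)
    have h2 := StW_cons w l
    rw [StW, map_add, h1, of_consL, ← plusl_E, ← h2]
    rfl

lemma SttW_cons (k w) : of (SttW (k :: w)) = - E k (of (SttW w)) := by
  simp [SttW, StW_cons, pow_succ]

lemma cons_mul_E (k m a h) : cons k a * E m h = cons k (a * E m h) + E m (cons k a * h) := by
  have : LinearMap.mul ℚ QS (cons k a) ∘ₗ E m = cons k ∘ₗ LinearMap.mul ℚ QS a ∘ₗ E m +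
      E m ∘ₗ LinearMap.mul ℚ QS (cons k a) := by
    refine hom_ext_cons ?_ fun l w _ => ?_
    · have := cons_mul_cons k m a 1
      simp only [LinearMap.comp_apply, LinearMap.add_apply, E, LinearMap.mul_apply', plusl_one,
        mul_one, plusl_cons, add_zero, add_comm m k] at this ⊢
      rw [this, add_assoc]
    · simp only [LinearMap.comp_apply, LinearMap.add_apply, E, LinearMap.mul_apply',
        plusl_cons, cons_mul_cons, map_add, add_comm m k, add_assoc,
        add_left_comm m k]
      abel
  exact LinearMap.congr_fun this h

/-- the antipode -/
noncomputable def A : QS →ₗ[ℚ] QS := lift fun w => of (SttW w.reverse)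

lemma A_one : A 1 = 1 := by
  simp [A, one_def, SttW, StW]; rfl

lemma A_snoc (m a) : A (snoc m a) = - E m (A a) := by
  have : A ∘ₗ snoc m = - (E m ∘ₗ A) := hom_ext fun w => by simp [A, SttW_cons]
  exact LinearMap.congr_fun this a

lemma K_cons (m k a) : cv .id (E m ∘ₗ A) (cons k a) =
    cons k (cv .id (E m ∘ₗ A) a) + E m (cv .id A (cons k a)) := by
  have h : ∀ X : QS ⊗[ℚ] QS, LinearMap.mul' ℚ QS (TensorProduct.map (cons k) (E m ∘ₗ A) X) =
      cons k (LinearMap.mul' ℚ QS (TensorProduct.map .id (E m ∘ₗ A) X)) +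
      E m (LinearMap.mul' ℚ QS (TensorProduct.map (cons k) A X)) := by
    intro X
    induction X using TensorProduct.induction_on with
    | zero => simp
    | add x y hx hy => simp only [map_add, hx, hy]; abel
    | tmul x y => simp [cons_mul_E]
  have h' := h (Del a)
  rw [cv_cons, cv_cons]
  simp only [cv, LinearMap.comp_apply, LinearMap.id_comp, LinearMap.id_apply, one_mul,
    map_add] at h' ⊢
  rw [h']; abel

lemma antipode_right_e (n : ℕ) : ∀ w : List ℕ+, w.length = n → cv .id A (e w) = cone (e w) := by
  induction n using Nat.strong_induction_on with
  | _ n ih =>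
  intro w hw
  rcases List.eq_nil_or_concat w with rfl | ⟨w, m, rfl⟩
  · rw [← one_def, cv_one, A_one]
    simp [cone]
  · have hK : ∀ v : List ℕ+, v.length < n → cv .id (E m ∘ₗ A) (e v) = snoc m (e v) := by
      intro v
      induction v with
      | nil =>
        intro _
        rw [← one_def, cv_one, LinearMap.comp_apply, A_one, E, LinearMap.add_apply, plusl_one,
          LinearMap.id_apply, one_mul, add_zero, one_def]
        simp
      | cons k v ihv =>
        intro hv
        have h1 := ihv (by simp at hv; omega)
        have h2 := ih _ hv (k :: v) rfl
        rw [← cons_e] at h2 ⊢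
        rw [K_cons, h1, h2, snoc_cons]
        simp [cone]
    have h3 := hK w (by simp at hw; omega)
    have h4 : A ∘ₗ snoc m = - (E m ∘ₗ A) := by ext a; exact A_snoc m a
    have h5 : cv .id (-(E m ∘ₗ A)) (e w) = - cv .id (E m ∘ₗ A) (e w) := by
      apply eq_neg_of_add_eq_zero_left
      simp only [cv, LinearMap.comp_apply, ← map_add, ← LinearMap.add_apply,
        ← TensorProduct.map_add_right]
      simp
    have h6 : eps (e (w ++ [m])) = 0 := by simp [eps]
    rw [List.concat_eq_append, cone, LinearMap.comp_apply, h6, ← snoc_e, cv_snoc, h4, h5, h3, A_one]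
    simp

lemma antipode_right : cv .id A = cone := hom_ext fun w => antipode_right_e _ w rfl

/-- right inverse construction -/
noncomputable def gW (f : QS →ₗ[ℚ] QS) : List ℕ+ → QS
  | [] => 1
  | k :: w => - ∑ i : Fin (w.length + 1), f (e (k :: w.take i)) * gW f (w.drop i)
  termination_by w => w.length
  decreasing_by simp

lemma exists_right_inv (f : QS →ₗ[ℚ] QS) (hf : f 1 = 1) : ∃ g, cv f g = cone := by
  refine ⟨lift (gW f), hom_ext fun w => ?_⟩
  cases w with
  | nil => rw [← one_def, cv_one, hf, one_def, lift_e, gW]; simp [cone, ← one_def]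
  | cons k w =>
    rw [← cons_e, cv_cons, cv_e, hf, cons_e, lift_e, gW, one_mul, Finset.sum_range]
    simp [cone]

lemma antipode_left : cv A .id = cone := by
  obtain ⟨g, hg⟩ := exists_right_inv A A_one
  have : LinearMap.id = g := by
    rw [← cv_cone .id, ← hg, ← cv_assoc, antipode_right, cone_cv]
  rw [this, hg]

noncomputable instance : HopfAlgebra ℚ QS where
  antipode := A
  mul_antipode_rTensor_comul := antipode_left
  mul_antipode_lTensor_comul := antipode_right

lemma A_mul (a b : QS) : A (a * b) = A a * A b := HopfAlgebra.antipode_mul_distrib (R := ℚ) a b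

lemma eps_A (a : QS) : eps (A a) = eps a := HopfAlgebra.counit_antipode (R := ℚ) a

/-- the derivation `z_k ↦ k z_{k+s}` on words -/
noncomputable def dW (s : ℕ) : List ℕ+ → QS
  | [] => 0
  | k :: w => (k : ℚ) • e (pplus k s :: w) + cons k (dW s w)

/-- the derivation `z_k ↦ k z_{k+s}` -/
noncomputable def dl (s : ℕ) : QS →ₗ[ℚ] QS := lift (dW s)

lemma dl_one (s) : dl s 1 = 0 := by simp [dl, one_def, dW]

lemma dl_cons (s k a) : dl s (cons k a) = (k : ℚ) • cons (pplus k s) a + cons k (dl s a) := by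
  have : dl s ∘ₗ cons k = (k : ℚ) • cons (pplus k s) + cons k ∘ₗ dl s :=
    hom_ext fun w => by simp [dl, dW]
  exact LinearMap.congr_fun this a

lemma pplus_coe (k : ℕ+) (s) : ((pplus k s : ℕ+) : ℕ) = k + s := rfl

lemma pplus_add (k l : ℕ+) (s) : pplus (k + l) s = pplus k s + l := by
  apply PNat.eq; simp only [pplus_coe, PNat.add_coe]; omega

lemma pplus_add' (k l : ℕ+) (s) : pplus (k + l) s = k + pplus l s := by
  apply PNat.eq; simp only [pplus_coe, PNat.add_coe]; omega

lemma dl_mul_e (s) : ∀ u v, dl s (e u * e v) = dl s (e u) * e v + e u * dl s (e v)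
  | [], v => by rw [← one_def, dl_one]; simp
  | u, [] => by rw [← one_def, dl_one]; simp
  | k :: u, l :: v => by
    have h1 := dl_mul_e s u (l :: v)
    have h2 := dl_mul_e s (k :: u) v
    have h3 := dl_mul_e s u v
    simp only [← cons_e] at *
    simp only [cons_mul_cons, map_add, dl_cons, h1, h2, h3, add_mul, mul_add, smul_mul_assoc,
      mul_smul_comm, map_smul, ← pplus_add, ← pplus_add', smul_add, PNat.add_coe, Nat.cast_add,
      add_smul]
    abel
  termination_by u v => u.length + v.length

lemma dl_mul (s) (a b : QS) : dl s (a * b) = dl s a * b + a * dl s b := by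
  have : (LinearMap.mul ℚ QS).compr₂ (dl s) = (LinearMap.mul ℚ QS) ∘ₗ dl s +
      (LinearMap.mul ℚ QS).compl₂ (dl s) :=
    hom_ext fun u => hom_ext fun v => dl_mul_e s u v
  exact LinearMap.congr_fun (LinearMap.congr_fun this a) b

lemma Del_dl (s a) : Del (dl s a) = (dl s).rTensor QS (Del a) + (dl s).lTensor QS (Del a) := by
  have : Del ∘ₗ dl s = (dl s).rTensor QS ∘ₗ Del + (dl s).lTensor QS ∘ₗ Del := by
    refine hom_ext_cons ?_ fun k w h => ?_
    · simp [dl_one, Del_one]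
    · simp only [LinearMap.comp_apply, LinearMap.add_apply] at h ⊢
      have h1 : ∀ X : QS ⊗[ℚ] QS, (dl s).rTensor QS ((cons k).rTensor QS X) =
          (k : ℚ) • (cons (pplus k s)).rTensor QS X +
            (cons k).rTensor QS ((dl s).rTensor QS X) := by
        intro X
        induction X using TensorProduct.induction_on with
        | zero => simp
        | add x y hx hy => simp only [map_add, hx, hy, smul_add]; abel
        | tmul x y => simp [dl_cons, TensorProduct.add_tmul, TensorProduct.smul_tmul']
      have h2 : ∀ X : QS ⊗[ℚ] QS, (dl s).lTensor QS ((cons k).rTensor QS X) =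
            (cons k).rTensor QS ((dl s).lTensor QS X) := by
        intro X
        induction X using TensorProduct.induction_on with
        | zero => simp
        | add x y hx hy => simp only [map_add, hx, hy]
        | tmul x y => simp
      simp only [dl_cons, Del_cons, map_add, h, map_smul, LinearMap.rTensor_tmul,
        LinearMap.lTensor_tmul, dl_one, TensorProduct.zero_tmul, h1, h2, TensorProduct.tmul_add,
        TensorProduct.tmul_smul, smul_add]
      abel
  exact LinearMap.congr_fun this a

lemma dl_snoc (s m a) : dl s (snoc m a) = (m : ℚ) • snoc (pplus m s) a + snoc m (dl s a) := by
  have : dl s ∘ₗ snoc m = (m : ℚ) • snoc (pplus m s) + snoc m ∘ₗ dl s := by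
    refine hom_ext_cons ?_ fun k w h => ?_
    · have : ∀ m, snoc m 1 = cons m 1 := fun m => by simp [one_def]
      simp [this, dl_cons, dl_one]
    · simp only [LinearMap.comp_apply, LinearMap.add_apply, LinearMap.smul_apply] at h ⊢
      simp only [snoc_cons, dl_cons, h, map_add, map_smul]
      abel
  exact LinearMap.congr_fun this a

lemma eps_dl (s a) : eps (dl s a) = 0 := by
  have : eps ∘ₗ dl s = 0 := hom_ext_cons (by simp [dl_one]) fun k w _ => by
    rw [LinearMap.comp_apply, dl_cons]; simp
  exact LinearMap.congr_fun this a

lemma dl_cv (s f g) : dl s ∘ₗ cv f g = cv (dl s ∘ₗ f) g + cv f (dl s ∘ₗ g) := by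
  ext a
  simp only [cv, LinearMap.comp_apply, LinearMap.add_apply]
  induction Del a using TensorProduct.induction_on with
  | zero => simp
  | add x y hx hy => simp only [map_add, hx, hy]; abel
  | tmul x y => simp [dl_mul]

lemma cv_dl (s f g) : cv f g ∘ₗ dl s = cv (f ∘ₗ dl s) g + cv f (g ∘ₗ dl s) := by
  ext a
  simp only [cv, LinearMap.comp_apply, LinearMap.add_apply, Del_dl, map_add]
  congr 2
  · rw [← LinearMap.comp_apply, LinearMap.map_comp_rTensor]
  · rw [← LinearMap.comp_apply, LinearMap.map_comp_lTensor]

lemma A_dl (s) : A ∘ₗ dl s = dl s ∘ₗ A := by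
  have h1 := dl_cv s .id A
  have h2 := cv_dl s .id A
  have e1 : dl s ∘ₗ cone = 0 := by
    ext a; simp [cone, Algebra.algebraMap_eq_smul_one, dl_one]
  have e2 : cone ∘ₗ dl s = 0 := by
    ext a; simp [cone, eps_dl]
  rw [antipode_right, e1] at h1
  rw [antipode_right, e2, h1] at h2
  simp only [LinearMap.comp_id, LinearMap.id_comp] at h2
  have h3 : cv .id (A ∘ₗ dl s) = cv .id (dl s ∘ₗ A) := (add_left_cancel h2).symm
  rw [← cone_cv (A ∘ₗ dl s), ← cone_cv (dl s ∘ₗ A), ← antipode_left, cv_assoc, cv_assoc, h3]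

lemma dl_comm : dl 0 ∘ₗ dl 1 = dl 1 ∘ₗ dl 0 + dl 1 := by
  refine hom_ext_cons (by simp [dl_one]) fun k w h => ?_
  have h0 : ∀ k, pplus k 0 = k := fun k => PNat.eq (by simp [pplus])
  have h1 : ((pplus k 1 : ℕ+) : ℚ) = k + 1 := by simp [pplus]
  simp only [LinearMap.comp_apply, LinearMap.add_apply] at h ⊢
  simp only [dl_cons, map_add, map_smul, h, h0, h1, smul_add, add_smul, one_smul, smul_smul]
  module

/-- the operators `ψ_s` -/
noncomputable def ps (s : ℕ) : QS →ₗ[ℚ] QS := cv .id (A ∘ₗ dl s)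

lemma ps_mul (s) (a b : QS) (ha : eps a = 0) (hb : eps b = 0) : ps s (a * b) = 0 := by
  have key : ∀ X Y : QS ⊗[ℚ] QS,
      LinearMap.mul' ℚ QS (TensorProduct.map .id (A ∘ₗ dl s) (X * Y)) =
      LinearMap.mul' ℚ QS (TensorProduct.map .id (A ∘ₗ dl s) X) *
        LinearMap.mul' ℚ QS (TensorProduct.map .id A Y) +
      LinearMap.mul' ℚ QS (TensorProduct.map .id A X) *
        LinearMap.mul' ℚ QS (TensorProduct.map .id (A ∘ₗ dl s) Y) := by
    intro X Y
    induction X using TensorProduct.induction_on with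
    | zero => simp
    | add x y hx hy => simp only [map_add, add_mul, hx, hy]; abel
    | tmul x y =>
      induction Y using TensorProduct.induction_on with
      | zero => simp
      | add x y hx hy => simp only [map_add, mul_add, hx, hy]; abel
      | tmul z t => simp [dl_mul, A_mul]; ring
  have hc : ∀ c, eps c = 0 → LinearMap.mul' ℚ QS (TensorProduct.map .id A (Del c)) = 0 := by
    intro c hc
    have := LinearMap.congr_fun antipode_right c
    simp only [cone, LinearMap.comp_apply, hc, map_zero, cv] at this
    exact this
  simp only [ps, cv, LinearMap.comp_apply, Del_mul, key]
  rw [hc a ha, hc b hb]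
  simp

lemma ps_dl : ps 0 ∘ₗ dl 1 = dl 1 ∘ₗ ps 0 + ps 1 := by
  have : A ∘ₗ dl 0 ∘ₗ dl 1 = dl 1 ∘ₗ A ∘ₗ dl 0 + A ∘ₗ dl 1 := by
    rw [dl_comm, LinearMap.comp_add, ← LinearMap.comp_assoc, A_dl, LinearMap.comp_assoc]
  rw [ps, ps, cv_dl, dl_cv, LinearMap.comp_assoc, this, add_assoc]
  congr 1
  ext a
  simp [cv, TensorProduct.map_add_right]

lemma cv_id_add (f g) : cv .id (f + g) = cv .id f + cv .id g := by
  ext a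
  simp [cv, TensorProduct.map_add_right]

/-- harmonic products of elements of the augmentation ideal -/
noncomputable def P : Submodule ℚ QS := Submodule.span ℚ {h | ∃ u v, eps u = 0 ∧ eps v = 0 ∧ h = u * v}

lemma mul_mem_P {u v : QS} (hu : eps u = 0) (hv : eps v = 0) : u * v ∈ P :=
  Submodule.subset_span ⟨u, v, hu, hv, rfl⟩

lemma ps_P (s) {x : QS} (hx : x ∈ P) : ps s x = 0 := by
  have : P ≤ LinearMap.ker (ps s) := by
    rw [P, Submodule.span_le]
    rintro _ ⟨u, v, hu, hv, rfl⟩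
    exact ps_mul s u v hu hv
  exact this hx

lemma eps_e_ne {w : List ℕ+} (h : w ≠ []) : eps (e w) = 0 := by simp [eps, h]

/-- induction on the augmentation ideal -/
lemma ideal_ind {S : Submodule ℚ QS} (f : QS →ₗ[ℚ] QS) (h : ∀ k w, f (e (k :: w)) ∈ S) (x : QS)
    (hx : eps x = 0) : f x ∈ S := by
  have : ∀ x, f (x - eps x • 1) ∈ S := by
    intro x
    induction x using ind with
    | h0 => simp
    | ha a b h1 h2 =>
      have := S.add_mem h1 h2
      rw [← map_add] at this
      convert this using 2
      rw [map_add, add_smul]; abel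
    | hs c a h1 =>
      have := S.smul_mem c h1
      rw [← map_smul] at this
      convert this using 2
      rw [map_smul, smul_sub, smul_smul, smul_eq_mul]
    | he w =>
      cases w with
      | nil => rw [← one_def]; simp
      | cons k w => simpa using h k w
  simpa [hx] using this x

lemma cv_mod (g : QS →ₗ[ℚ] QS) (hg : ∀ x, eps x = 0 → eps (g x) = 0) (x : QS) (hx : eps x = 0) :
    (cv .id g - g - LinearMap.mulRight ℚ (g 1)) x ∈ P := by
  refine ideal_ind _ (fun k w => ?_) x hx
  simp only [LinearMap.sub_apply, cv_e, List.length_cons]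
  rw [Finset.sum_range_succ, Finset.sum_range_succ']
  have : ∀ a b c : QS, a + b + c - b - c = a := fun a b c => by abel
  have h2 : (k :: w).drop (w.length + 1) = [] := by simp
  have h3 : (k :: w).take (w.length + 1) = k :: w := by simp
  rw [h2, h3, ← one_def]
  simp only [List.take_zero, List.drop_zero, ← one_def, LinearMap.id_apply, one_mul,
    LinearMap.mulRight_apply, this]
  refine Submodule.sum_mem _ fun i hi => mul_mem_P ?_ ?_
  · exact eps_e_ne (by simp)
  · refine hg _ (eps_e_ne ?_)
    simp at hi ⊢
    exact hi

lemma A_mod (x : QS) (hx : eps x = 0) : A x + x ∈ P := by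
  have := cv_mod A (fun x hx => by rw [eps_A, hx]) x hx
  rw [antipode_right, A_one] at this
  simp only [LinearMap.sub_apply, cone, LinearMap.comp_apply, hx, map_zero,
    LinearMap.mulRight_apply, mul_one] at this
  rw [← neg_mem_iff]
  convert this using 1
  abel

lemma ps_mod (s) (x : QS) (hx : eps x = 0) : ps s x + dl s x ∈ P := by
  have h1 := cv_mod (A ∘ₗ dl s) (fun x hx => by rw [LinearMap.comp_apply, eps_A, eps_dl]) x hx
  have h2 := A_mod (dl s x) (eps_dl s x)
  have h3 := P.add_mem h1 h2
  convert h3 using 1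
  simp [ps, dl_one]
  abel

lemma eps_ps (s x) : eps (ps s x) = 0 := by
  have : eps ∘ₗ ps s = 0 := by
    ext a
    simp only [ps, cv, LinearMap.comp_apply]
    induction Del a using TensorProduct.induction_on with
    | zero => simp
    | add x y hx hy => simp_all
    | tmul x y => simp [eps_mul, eps_A, eps_dl]
  exact LinearMap.congr_fun this x

/-- removing a first letter `j` -/
noncomputable def tl (j : ℕ+) : QS →ₗ[ℚ] QS := lift fun w => match w with
  | [] => 0
  | k :: w => if k = j then e w else 0

lemma tl_one (j) : tl j 1 = 0 := by simp [tl, one_def]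
lemma tl_cons (j k a) : tl j (cons k a) = if k = j then a else 0 := by
  have : tl j ∘ₗ cons k = if k = j then LinearMap.id else 0 := hom_ext fun w => by
    split_ifs with h <;> simp [tl, h]
  have := LinearMap.congr_fun this a
  split_ifs at this ⊢ <;> exact this

lemma tl_dl (j a) : tl (j + 1) (dl 1 a) = (j : ℚ) • tl j a + dl 1 (tl (j + 1) a) := by
  have : tl (j + 1) ∘ₗ dl 1 = (j : ℚ) • tl j + dl 1 ∘ₗ tl (j + 1) := by
    refine hom_ext_cons (by simp [dl_one, tl_one]) fun k w _ => ?_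
    have h1 : pplus k 1 = k + 1 := rfl
    simp only [LinearMap.comp_apply, LinearMap.add_apply, LinearMap.smul_apply, dl_cons, map_add,
      map_smul, tl_cons, h1, add_left_inj]
    split_ifs with h2 h3 <;> simp_all
  exact LinearMap.congr_fun this a

lemma tl_bound (a) : ∃ M : ℕ+, ∀ j, M ≤ j → tl j a = 0 := by
  induction a using ind with
  | h0 => exact ⟨1, by simp⟩
  | ha a b h1 h2 =>
    obtain ⟨M, hM⟩ := h1
    obtain ⟨N, hN⟩ := h2
    exact ⟨max M N, fun j hj => by
      rw [map_add, hM j (le_trans (le_max_left _ _) hj), hN j (le_trans (le_max_right _ _) hj),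
        add_zero]⟩
  | hs c a h1 =>
    obtain ⟨M, hM⟩ := h1
    exact ⟨M, fun j hj => by rw [map_smul, hM j hj, smul_zero]⟩
  | he w =>
    cases w with
    | nil => exact ⟨1, fun j _ => tl_one j⟩
    | cons k w =>
      refine ⟨k + 1, fun j hj => ?_⟩
      rw [← cons_e, tl_cons, if_neg]
      rintro rfl
      exact absurd hj (not_le.2 (PNat.lt_add_right k 1))

lemma coeff_e (w v) : (of.symm (e w)) v = if w = v then 1 else 0 := by
  simp [e, W, Finsupp.single_apply]

lemma coeff_tl (j a w) : (of.symm (tl j a)) w = (of.symm a) (j :: w) := by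
  have : Finsupp.lapply w ∘ₗ of.symm.toLinearMap ∘ₗ tl j =
      Finsupp.lapply (R := ℚ) (M := ℚ) (j :: w) ∘ₗ of.symm.toLinearMap := by
    refine hom_ext fun v => ?_
    cases v with
    | nil =>
      have := tl_one j
      rw [one_def] at this
      simp [this, coeff_e]
    | cons k v =>
      simp only [LinearMap.comp_apply]
      rw [← cons_e, tl_cons, cons_e]
      split_ifs with h
      · subst h; simp [coeff_e]
      · simp [coeff_e, h]
  exact LinearMap.congr_fun this a

lemma coeff_nil (a) : (of.symm a) [] = eps a := by
  have : Finsupp.lapply [] ∘ₗ of.symm.toLinearMap = eps := by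
    refine hom_ext fun v => ?_
    simp [eps, coeff_e]
  exact LinearMap.congr_fun this a

lemma dl_inj (a) (ha : eps a = 0) (h : dl 1 a = 0) : a = 0 := by
  obtain ⟨M, hM⟩ := tl_bound a
  have key : ∀ n : ℕ, ∀ j : ℕ+, (M : ℕ) ≤ j + n → tl j a = 0 := by
    intro n
    induction n with
    | zero => intro j hj; exact hM j (by simpa using hj)
    | succ n ih =>
      intro j hj
      have h1 := tl_dl j a
      rw [h, ih (j + 1) (by rw [PNat.add_coe]; simp; omega), map_zero, map_zero, add_zero] at h1
      have h2 : (j : ℚ) ≠ 0 := by exact_mod_cast j.ne_zero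
      exact (smul_eq_zero.1 h1.symm).resolve_left h2
  apply of.symm.injective
  ext w
  rw [map_zero]
  cases w with
  | nil => rw [coeff_nil, ha]; rfl
  | cons k w => rw [← coeff_tl, key M k (by omega), map_zero]; rfl

/-- weight of a word -/
def wt (w : List ℕ+) : ℚ := (w.map fun k : ℕ+ => (k : ℚ)).sum

lemma wt_pos (k w) : 0 < wt (k :: w) := by
  have : ∀ w, 0 ≤ wt w := by
    intro w
    induction w with
    | nil => simp [wt]
    | cons k w ih => simp only [wt, List.map_cons, List.sum_cons] at ih ⊢; positivity
  have h1 : (0 : ℚ) < k := by exact_mod_cast k.pos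
  have h2 := this w
  simp only [wt, List.map_cons, List.sum_cons] at h2 ⊢
  linarith

lemma dl_zero_e (w) : dl 0 (e w) = wt w • e w := by
  have h0 : ∀ k, pplus k 0 = k := fun k => PNat.eq (by simp [pplus])
  induction w with
  | nil => rw [← one_def]; simp [dl_one, wt]
  | cons k w ih =>
    rw [← cons_e, dl_cons, ih, h0]
    simp [wt, add_smul]

/-- inverse of the weight operator -/
noncomputable def ninv : QS →ₗ[ℚ] QS := lift fun w => (wt w)⁻¹ • e w

lemma ninv_dl (x) (hx : eps x = 0) : ninv (dl 0 x) = x := by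
  have := ideal_ind (S := ⊥) (ninv ∘ₗ dl 0 - LinearMap.id) (fun k w => by
    simp [dl_zero_e, ninv, smul_smul, mul_inv_cancel₀ (wt_pos k w).ne']) x hx
  simpa [sub_eq_zero] using this

lemma ninv_P {x} (hx : x ∈ P) : ninv x ∈ P := by
  have : P ≤ P.comap ninv := by
    conv_lhs => rw [P]
    rw [Submodule.span_le]
    rintro _ ⟨u, v, hu, hv, rfl⟩
    have h1 : ∀ k w, ninv (e (k :: w) * v) ∈ P := fun k w => by
      refine ideal_ind (ninv ∘ₗ LinearMap.mulLeft ℚ (e (k :: w))) (fun l t => ?_) v hv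
      have h2 : eps (e (k :: w) * e (l :: t)) = 0 := by simp [eps_mul]
      have h3 := ninv_dl _ h2
      rw [dl_mul, dl_zero_e, dl_zero_e, smul_mul_assoc, mul_smul_comm, ← add_smul, map_smul] at h3
      have h4 : wt (k :: w) + wt (l :: t) ≠ 0 := (add_pos (wt_pos _ _) (wt_pos _ _)).ne'
      have h5 := P.smul_mem (wt (k :: w) + wt (l :: t))⁻¹
        (mul_mem_P (eps_e_cons k w) (eps_e_cons l t))
      rw [← h3, smul_smul, inv_mul_cancel₀ h4, one_smul] at h5
      exact h5
    exact ideal_ind (ninv ∘ₗ LinearMap.mulRight ℚ v) h1 u hu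
  exact this hx

theorem main (x : QS) (hx : eps x = 0) : ps 1 x = 0 ↔ x ∈ P := by
  refine ⟨fun h => ?_, ps_P 1⟩
  have h1 := ps_mod 1 x hx
  rw [h, zero_add] at h1
  have h2 := LinearMap.congr_fun ps_dl x
  simp only [LinearMap.comp_apply, LinearMap.add_apply] at h2
  rw [ps_P 0 h1, h, add_zero] at h2
  have h3 := dl_inj _ (eps_ps 0 x) h2.symm
  have h4 := ps_mod 0 x hx
  rw [h3, zero_add] at h4
  have h5 := ninv_P h4
  rwa [ninv_dl x hx] at h5

/-! Comparison with the frozen definitions. -/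

lemma sigW_zero (w) : of (sigW 0 w) = e w := by
  have h0 : ∀ k, pplus k 0 = k := fun k => PNat.eq (by simp [pplus])
  induction w with
  | nil => simp [sigW, e]
  | cons k w ih => simp [sigW, of_consL, ih, h0]

lemma sigW_one (w) : of (sigW 1 w) = dl 1 (e w) := by
  have h0 : ∀ k, pplus k 0 = k := fun k => PNat.eq (by simp [pplus])
  induction w with
  | nil => simp [sigW, dl, dW]
  | cons k w ih =>
    rw [← cons_e, dl_cons]
    simp [sigW, of_consL, ih, h0, sigW_zero, Finset.sum_range_succ, add_comm]

/-- reversal -/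
noncomputable def rv : QS →ₗ[ℚ] QS := lift fun w => e w.reverse

lemma rv_dl (a) : rv (dl 1 a) = dl 1 (rv a) := by
  have hc : ∀ k a, rv (cons k a) = snoc k (rv a) := fun k a => by
    have : rv ∘ₗ cons k = snoc k ∘ₗ rv := hom_ext fun w => by simp [rv]
    exact LinearMap.congr_fun this a
  have : rv ∘ₗ dl 1 = dl 1 ∘ₗ rv := hom_ext_cons (by simp [rv, one_def, dl, dW])
    fun k w h => by
      simp only [LinearMap.comp_apply] at h ⊢
      rw [dl_cons, map_add, map_smul, hc, hc, hc, h, dl_snoc]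
  exact LinearMap.congr_fun this a

lemma of_Stt (h : H1) : of (Stt h) = A (rv (of h)) := by
  have h1 : A ∘ₗ rv = lift fun w => of (SttW w) := hom_ext fun w => by simp [A, rv]
  have h2 := LinearMap.congr_fun h1 (of h)
  rw [LinearMap.comp_apply] at h2
  rw [h2, lift_of, Stt]
  simp [Finsupp.sum]

lemma of_psiW (w) : of (psiW w) = ps 1 (e w) := by
  rw [ps, cv_e, Finset.sum_range_succ, psiW, map_sum]
  have h1 : w.drop w.length = [] := by simp
  rw [h1, ← one_def, LinearMap.comp_apply, dl_one, map_zero, mul_zero, add_zero]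
  refine Finset.sum_congr rfl fun i _ => ?_
  rw [of_harm, of_Stt, sigW_one, rv_dl]
  rw [← mul_def, ← e, rv, lift_e, List.reverse_reverse, LinearMap.id_apply,
    LinearMap.comp_apply]

lemma of_psi (h : H1) : of (psi h) = ps 1 (of h) := by
  have h1 : ps 1 = lift fun w => of (psiW w) := hom_ext fun w => by simp [of_psiW]
  rw [h1, lift_of, psi]
  simp [Finsupp.sum]

lemma mem_yH1 (h : H1) : h ∈ yH1 ↔ eps (of h) = 0 := by
  constructor
  · intro hh
    have : yH1 ≤ LinearMap.ker (eps ∘ₗ of.toLinearMap) := by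
      rw [yH1, Submodule.span_le]
      rintro _ ⟨k, w, rfl⟩
      exact eps_e_cons k w
    exact this hh
  · intro hh
    exact ideal_ind (S := yH1.comap of.symm.toLinearMap) LinearMap.id
      (fun k w => Submodule.subset_span ⟨k, w, rfl⟩) (of h) hh

lemma mem_harmSpan (h : H1) : h ∈ harmSpan ↔ of h ∈ P := by
  have : harmSpan = P.comap of.toLinearMap := by
    apply le_antisymm
    · rw [harmSpan, Submodule.span_le]
      rintro _ ⟨u, hu, v, hv, rfl⟩
      rw [mem_yH1] at hu hv
      have := mul_mem_P hu hv
      rw [mul_def, ← of_harm] at this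
      exact this
    · have : P ≤ harmSpan.comap of.symm.toLinearMap := by
        rw [P, Submodule.span_le]
        rintro _ ⟨u, v, hu, hv, rfl⟩
        refine Submodule.subset_span ⟨of.symm u, (mem_yH1 _).2 hu, of.symm v, (mem_yH1 _).2 hv, ?_⟩
        apply of.injective
        rw [of_harm]; rfl
      intro x hx
      exact this hx
  rw [this]; rfl

end QS

/-- `ker ψ = yH ∗ yH`. -/
theorem psi_kernel_eq (w : H1) (hw : w ∈ yH1) : psi w = 0 ↔ w ∈ harmSpan := by
  rw [QS.mem_harmSpan, ← QS.main _ ((QS.mem_yH1 w).1 hw), ← QS.of_psi]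
  exact (QS.of.map_eq_zero_iff).symm
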